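/- Fix integers N ≥ 1, K ≥ 1 and a real q > 0, and for u > 0 set a(u) = N·log((Ku/q + 1)/(Ku + 1)) and w*(u) = g(a(u)), where g(a) = (a + 2 − √(a² + 4))/(2a) for a ≠ 0 and g(0) = 1/2. If q > 1 then u ↦ a(u) is strictly decreasing on (0,∞) and hence the D-optimal allocation rate w*(u) is strictly increasing in u; if 0 < q < 1 then u ↦ a(u) is strictly increasing and w*(u) is strictly decreasing in u. -/

import Mathlib

/-- The D-optimal allocation rate as a function of `a`, with `g(0) = 1/2`. -/
noncomputable def gDOpt (a : ℝ) : ℝ :=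
  if a = 0 then 1 / 2 else (a + 2 - Real.sqrt (a ^ 2 + 4)) / (2 * a)

/-- `√(a² + 4)` strictly dominates `-a`. -/
lemma neg_lt_sqrt_sq_add_four (a : ℝ) : -a < √(a ^ 2 + 4) :=
  Real.lt_sqrt_of_sq_lt (by nlinarith)

lemma strictMono_add_sqrt_sq_add_four : StrictMono fun a : ℝ => a + √(a ^ 2 + 4) := by
  intro a b hab
  have hb := neg_lt_sqrt_sq_add_four b
  have hsq : √(b ^ 2 + 4) ^ 2 = b ^ 2 + 4 := Real.sq_sqrt (by positivity)
  have : √(a ^ 2 + 4) < (b - a) + √(b ^ 2 + 4) := by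
    rw [Real.sqrt_lt' (add_pos_of_pos_of_nonneg (sub_pos.2 hab) (Real.sqrt_nonneg _))]
    nlinarith [mul_pos (sub_pos.2 hab) (neg_lt_iff_pos_add.1 hb)]
  change a + √(a ^ 2 + 4) < b + √(b ^ 2 + 4)
  linarith

/-- The rationalized form of `gDOpt`, valid at `0` as well. -/
lemma gDOpt_eq (a : ℝ) : gDOpt a = 2 / (a + √(a ^ 2 + 4) + 2) := by
  unfold gDOpt
  split_ifs with h
  · have h4 : √(4 : ℝ) = 2 := by
      rw [show (4 : ℝ) = 2 ^ 2 by norm_num]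
      exact Real.sqrt_sq (by norm_num)
    subst h
    norm_num [h4]
  · have hpos := neg_lt_sqrt_sq_add_four a
    have hsq : √(a ^ 2 + 4) ^ 2 = a ^ 2 + 4 := Real.sq_sqrt (by positivity)
    rw [div_eq_div_iff (by simpa using h) (by linarith)]
    linear_combination -hsq

lemma gDOpt_strictAnti : StrictAnti gDOpt := by
  intro a b hab
  rw [gDOpt_eq, gDOpt_eq]
  have ha := neg_lt_sqrt_sq_add_four a
  have h : a + √(a ^ 2 + 4) < b + √(b ^ 2 + 4) := strictMono_add_sqrt_sq_add_four hab
  exact div_lt_div_of_pos_left two_pos (by linarith) (by linarith)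

/-- A Möbius ratio `(c u + 1) / (k u + 1)` with `c < k` is strictly decreasing on `(0, ∞)`. -/
lemma add_one_div_add_one_lt {c k x y : ℝ} (hk : 0 < k) (hck : c < k) (hx : 0 < x)
    (hxy : x < y) : (c * y + 1) / (k * y + 1) < (c * x + 1) / (k * x + 1) := by
  have hy := hx.trans hxy
  rw [div_lt_div_iff₀ (by positivity) (by positivity)]
  nlinarith [mul_pos (sub_pos.2 hck) (sub_pos.2 hxy)]

/-- For `0 < c < k`, the scaled log-ratio `n log ((c u + 1) / (k u + 1))` is strictly
decreasing on `(0, ∞)`. -/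
lemma strictAntiOn_mul_log_div {n c k : ℝ} (hn : 0 < n) (hc : 0 < c) (hck : c < k) :
    StrictAntiOn (fun u => n * Real.log ((c * u + 1) / (k * u + 1))) (Set.Ioi 0) := by
  intro x hx y hy hxy
  have hk := hc.trans hck
  rw [Set.mem_Ioi] at hx hy
  exact mul_lt_mul_of_pos_left
    (Real.log_lt_log (by positivity) (add_one_div_add_one_lt hk hck hx hxy)) hn

/-- For `0 < k < c`, the scaled log-ratio `n log ((c u + 1) / (k u + 1))` is strictly
increasing on `(0, ∞)`. -/
lemma strictMonoOn_mul_log_div {n c k : ℝ} (hn : 0 < n) (hk : 0 < k) (hkc : k < c) :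
    StrictMonoOn (fun u => n * Real.log ((c * u + 1) / (k * u + 1))) (Set.Ioi 0) := by
  have h := (strictAntiOn_mul_log_div hn hk hkc).neg
  refine h.congr fun u _ => ?_
  beta_reduce
  rw [← inv_div (c * u + 1), Real.log_inv]
  ring

/-- With a fixed variance ratio `q = u/v`, set `a(u) = N·log((Ku/q+1)/(Ku+1))` and
`w*(u) = g(a(u))`.  If `q > 1` then `a` is strictly decreasing on `(0,∞)` and hence the
D-optimal allocation rate `w*` is strictly increasing in `u`; if `0 < q < 1` then `a` is
strictly increasing and `w*` is strictly decreasing in `u`. -/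
theorem wDOpt_monotone_in_u_fixed_ratio
    (N K : ℕ) (hN : 1 ≤ N) (hK : 1 ≤ K) (q : ℝ) (hq : 0 < q) :
    (1 < q →
      StrictAntiOn
        (fun u => (N : ℝ) * Real.log (((K : ℝ) * u / q + 1) / ((K : ℝ) * u + 1)))
        (Set.Ioi 0)
      ∧ StrictMonoOn
          (fun u => gDOpt ((N : ℝ) * Real.log (((K : ℝ) * u / q + 1) / ((K : ℝ) * u + 1))))
          (Set.Ioi 0))
    ∧ (q < 1 →
      StrictMonoOn
        (fun u => (N : ℝ) * Real.log (((K : ℝ) * u / q + 1) / ((K : ℝ) * u + 1)))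
        (Set.Ioi 0)
      ∧ StrictAntiOn
          (fun u => gDOpt ((N : ℝ) * Real.log (((K : ℝ) * u / q + 1) / ((K : ℝ) * u + 1))))
          (Set.Ioi 0)) := by
  have hn : (0 : ℝ) < N := by exact_mod_cast hN
  have hk : (0 : ℝ) < K := by exact_mod_cast hK
  simp only [mul_div_right_comm (K : ℝ) _ q]
  refine ⟨fun h => ?_, fun h => ?_⟩
  · have ha := strictAntiOn_mul_log_div hn (div_pos hk hq) (div_lt_self hk h)
    exact ⟨ha, gDOpt_strictAnti.comp_strictAntiOn ha⟩
  · have hm := strictMonoOn_mul_log_div hn hk ((lt_div_iff₀ hq).2 (mul_lt_of_lt_one_right hk h))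
    exact ⟨hm, gDOpt_strictAnti.comp_strictMonoOn hm⟩
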